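/- For any integer m ≥ 1 and any real number q > 1, Σ_{k=0}^{m} q^{2k(m−k)} · binom(m,k)_{q²} ≤ 2(q+1)^{m²−1} if m is odd, and Σ_{k=0}^{m} q^{2k(m−k)} · binom(m,k)_{q²} ≤ (q+1)^{m²} if m is even. -/

import Mathlib

open Matrix CategoryTheory
open scoped Classical

noncomputable section

/-- The Frobenius–Schur indicator of a complex-valued function on a finite group. -/
def fsIndicator (G : Type*) [Group G] [Fintype G] (χ : G → ℂ) : ℂ :=
  (Fintype.card G : ℂ)⁻¹ * ∑ g : G, χ (g * g)

/-- The twisted Frobenius–Schur indicator of a complex-valued function on a finite group,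
with respect to a map `σ`. -/
def twistedFSIndicator (G : Type*) [Group G] [Fintype G] (σ : G → G) (χ : G → ℂ) : ℂ :=
  (Fintype.card G : ℂ)⁻¹ * ∑ g : G, χ (g * σ g)

/-- A complex-valued function is real-valued if all its values are real. -/
def IsRealValued {G : Type*} (χ : G → ℂ) : Prop := ∀ g : G, ∃ r : ℝ, χ g = (r : ℂ)

/-- The Gaussian binomial coefficient `binom(m,k)_q` as a real number. -/
def gbinom (m k : ℕ) (q : ℝ) : ℝ := ∏ i ∈ Finset.Icc 1 k, (q ^ (m - k + i) - 1) / (q ^ i - 1)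

section Groups

variable {N F : Type*} [Fintype N] [DecidableEq N] [Field F]

theorem sim_one (J : Matrix N N F) :
    ((1 : GL N F) : Matrix N N F)ᵀ * J * ((1 : GL N F) : Matrix N N F) = ((1 : Fˣ) : F) • J := by
  simp

theorem sim_mul {J : Matrix N N F} (a b : GL N F) (c d : Fˣ)
    (hc : (a : Matrix N N F)ᵀ * J * (a : Matrix N N F) = (c : F) • J)
    (hd : (b : Matrix N N F)ᵀ * J * (b : Matrix N N F) = (d : F) • J) :
    ((a * b : GL N F) : Matrix N N F)ᵀ * J * ((a * b : GL N F) : Matrix N N F)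
      = ((c * d : Fˣ) : F) • J := by
  calc ((a * b : GL N F) : Matrix N N F)ᵀ * J * ((a * b : GL N F) : Matrix N N F)
      = (b : Matrix N N F)ᵀ * ((a : Matrix N N F)ᵀ * J * (a : Matrix N N F)) *
          (b : Matrix N N F) := by
        rw [show ((a * b : GL N F) : Matrix N N F) = (a : Matrix N N F) * b from rfl,
          transpose_mul]
        simp only [Matrix.mul_assoc]
    _ = (b : Matrix N N F)ᵀ * ((c : F) • J) * (b : Matrix N N F) := by rw [hc]
    _ = (c : F) • ((b : Matrix N N F)ᵀ * J * (b : Matrix N N F)) := by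
        rw [Matrix.mul_smul, Matrix.smul_mul]
    _ = (c : F) • ((d : F) • J) := by rw [hd]
    _ = ((c * d : Fˣ) : F) • J := by rw [smul_smul, Units.val_mul]

theorem sim_inv {J : Matrix N N F} (a : GL N F) (c : Fˣ)
    (hc : (a : Matrix N N F)ᵀ * J * (a : Matrix N N F) = (c : F) • J) :
    ((a⁻¹ : GL N F) : Matrix N N F)ᵀ * J * ((a⁻¹ : GL N F) : Matrix N N F)
      = ((c⁻¹ : Fˣ) : F) • J := by
  have ht : ((a⁻¹ : GL N F) : Matrix N N F)ᵀ * (a : Matrix N N F)ᵀ = 1 := by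
    rw [← transpose_mul, a.mul_inv, transpose_one]
  have key : ((a⁻¹ : GL N F) : Matrix N N F)ᵀ * ((a : Matrix N N F)ᵀ * J * (a : Matrix N N F)) *
      ((a⁻¹ : GL N F) : Matrix N N F) = J := by
    calc ((a⁻¹ : GL N F) : Matrix N N F)ᵀ * ((a : Matrix N N F)ᵀ * J * (a : Matrix N N F)) *
        ((a⁻¹ : GL N F) : Matrix N N F)
        = (((a⁻¹ : GL N F) : Matrix N N F)ᵀ * (a : Matrix N N F)ᵀ) * J *
          ((a : Matrix N N F) * ((a⁻¹ : GL N F) : Matrix N N F)) := by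
          simp only [Matrix.mul_assoc]
      _ = J := by rw [ht, a.mul_inv, Matrix.one_mul, Matrix.mul_one]
  have key2 : ((a⁻¹ : GL N F) : Matrix N N F)ᵀ * ((c : F) • J) * ((a⁻¹ : GL N F) : Matrix N N F)
      = (c : F) • (((a⁻¹ : GL N F) : Matrix N N F)ᵀ * J * ((a⁻¹ : GL N F) : Matrix N N F)) := by
    rw [Matrix.mul_smul, Matrix.smul_mul]
  have h3 : (c : F) • (((a⁻¹ : GL N F) : Matrix N N F)ᵀ * J *
      ((a⁻¹ : GL N F) : Matrix N N F)) = J := by rw [← key2, ← hc, key]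
  calc ((a⁻¹ : GL N F) : Matrix N N F)ᵀ * J * ((a⁻¹ : GL N F) : Matrix N N F)
      = ((c⁻¹ : Fˣ) : F) • ((c : F) • (((a⁻¹ : GL N F) : Matrix N N F)ᵀ * J *
          ((a⁻¹ : GL N F) : Matrix N N F))) := by
        rw [smul_smul, ← Units.val_mul, inv_mul_cancel, Units.val_one, one_smul]
    _ = ((c⁻¹ : Fˣ) : F) • J := by rw [h3]

/-- The similitude group of the bilinear form given by the matrix `J`:  all invertible
matrices `g` with `gᵀ * J * g = c • J` for some nonzero scalar `c` (the similitude of `g`). -/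
def similitudeGroup (J : Matrix N N F) : Subgroup (GL N F) where
  carrier := {g | ∃ c : Fˣ, (g : Matrix N N F)ᵀ * J * (g : Matrix N N F) = (c : F) • J}
  one_mem' := ⟨1, sim_one J⟩
  mul_mem' := by rintro a b ⟨c, hc⟩ ⟨d, hd⟩; exact ⟨c * d, sim_mul a b c d hc hd⟩
  inv_mem' := by rintro a ⟨c, hc⟩; exact ⟨c⁻¹, sim_inv a c hc⟩

/-- The isometry group of the bilinear form given by the matrix `J`:  all invertible
matrices `g` with `gᵀ * J * g = J`. -/
def fixGroup (J : Matrix N N F) : Subgroup (GL N F) where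
  carrier := {g | (g : Matrix N N F)ᵀ * J * (g : Matrix N N F) = J}
  one_mem' := by simp
  mul_mem' := by
    intro a b ha hb
    have := sim_mul (J := J) a b 1 1 (by simpa using ha) (by simpa using hb)
    simpa using this
  inv_mem' := by
    intro a ha
    have := sim_inv (J := J) a 1 (by simpa using ha)
    simpa using this

/-- The group of isometries of determinant one of the bilinear form given by the matrix `J`. -/
def specialFixGroup (J : Matrix N N F) : Subgroup (GL N F) where
  carrier := {g | (g : Matrix N N F)ᵀ * J * (g : Matrix N N F) = J ∧
    ((g : Matrix N N F)).det = 1}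
  one_mem' := ⟨by simp, by simp⟩
  mul_mem' := by
    rintro a b ⟨ha1, ha2⟩ ⟨hb1, hb2⟩
    refine ⟨(fixGroup J).mul_mem ha1 hb1, ?_⟩
    rw [show ((a * b : GL N F) : Matrix N N F) = (a : Matrix N N F) * b from rfl,
      Matrix.det_mul, ha2, hb2, one_mul]
  inv_mem' := by
    rintro a ⟨ha1, ha2⟩
    refine ⟨(fixGroup J).inv_mem ha1, ?_⟩
    have h := congrArg Matrix.det a.mul_inv
    rw [Matrix.det_mul, ha2, one_mul, Matrix.det_one] at h
    exact h

/-- The connected component of the similitude group of the symmetric bilinear form on a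
`2 * m`-dimensional space given by the matrix `J`:  all similitudes `g`, with similitude
character `μ`, such that `det g = μ(g) ^ m`. -/
def connSimilitudeGroup (J : Matrix N N F) (m : ℕ) : Subgroup (GL N F) where
  carrier := {g | ∃ c : Fˣ, (g : Matrix N N F)ᵀ * J * (g : Matrix N N F) = (c : F) • J ∧
    ((g : Matrix N N F)).det = (c : F) ^ m}
  one_mem' := ⟨1, sim_one J, by simp⟩
  mul_mem' := by
    rintro a b ⟨c, hc1, hc2⟩ ⟨d, hd1, hd2⟩
    refine ⟨c * d, sim_mul a b c d hc1 hd1, ?_⟩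
    rw [show ((a * b : GL N F) : Matrix N N F) = (a : Matrix N N F) * b from rfl,
      Matrix.det_mul, hc2, hd2, Units.val_mul, mul_pow]
  inv_mem' := by
    rintro a ⟨c, hc1, hc2⟩
    refine ⟨c⁻¹, sim_inv a c hc1, ?_⟩
    have h := congrArg Matrix.det a.mul_inv
    rw [Matrix.det_mul, hc2, Matrix.det_one] at h
    have hc : ((c : F) ^ m)⁻¹ = ((c⁻¹ : Fˣ) : F) ^ m := by
      rw [← inv_pow]
      norm_cast
    rw [← hc]
    exact (inv_eq_of_mul_eq_one_right h).symm

theorem neg_one_mem_similitudeGroup (J : Matrix N N F) : (-1 : GL N F) ∈ similitudeGroup J := by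
  refine ⟨1, ?_⟩
  have h : ((-1 : GL N F) : Matrix N N F) = -1 := by simp
  rw [h]
  simp

/-- The standard symplectic form matrix `[[0, I], [-I, 0]]`. -/
def Jsp (n : ℕ) (F : Type*) [Field F] : Matrix (Fin n ⊕ Fin n) (Fin n ⊕ Fin n) F :=
  Matrix.fromBlocks 0 1 (-1) 0

/-- The standard split symmetric form matrix `[[0, I], [I, 0]]`. -/
def Jsplit (n : ℕ) (F : Type*) [Field F] : Matrix (Fin n ⊕ Fin n) (Fin n ⊕ Fin n) F :=
  Matrix.fromBlocks 0 1 1 0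

/-- A symmetric matrix `J` of size `2n` is split if it is congruent to `[[0, I], [I, 0]]`. -/
def IsSplit {n : ℕ} (J : Matrix (Fin n ⊕ Fin n) (Fin n ⊕ Fin n) F) : Prop :=
  ∃ P : GL (Fin n ⊕ Fin n) F,
    (P : Matrix (Fin n ⊕ Fin n) (Fin n ⊕ Fin n) F)ᵀ * J * P = Jsplit n F

/-- The symplectic similitude group `GSp(2n, F)`. -/
def GSp (n : ℕ) (F : Type*) [Field F] : Subgroup (GL (Fin n ⊕ Fin n) F) :=
  similitudeGroup (Jsp n F)

/-- The symplectic group `Sp(2n, F)`. -/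
def Sp (n : ℕ) (F : Type*) [Field F] : Subgroup (GL (Fin n ⊕ Fin n) F) :=
  fixGroup (Jsp n F)


/-- The underlying matrix of an element of a matrix subgroup. -/
def matOf {S : Subgroup (GL N F)} (g : ↥S) : Matrix N N F := ((g : GL N F) : Matrix N N F)

end Groups

noncomputable instance subgroupFintype {G : Type*} [Group G] [Finite G] (S : Subgroup G) :
    Fintype S := Fintype.ofFinite _

theorem gbinom_nonneg (m k : ℕ) {Q : ℝ} (hQ : 1 < Q) : 0 ≤ gbinom m k Q :=
  Finset.prod_nonneg fun _ _ =>
    div_nonneg (sub_nonneg.2 (one_le_pow₀ hQ.le)) (sub_nonneg.2 (one_le_pow₀ hQ.le))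

theorem gbinom_zero_right (m : ℕ) (Q : ℝ) : gbinom m 0 Q = 1 := by
  simp [gbinom]

theorem gbinom_self (m : ℕ) {Q : ℝ} (hQ : 1 < Q) : gbinom m m Q = 1 := by
  refine Finset.prod_eq_one fun i hi => ?_
  have hi0 : i ≠ 0 := by have := (Finset.mem_Icc.1 hi).1; omega
  rw [Nat.sub_self, zero_add, div_self (sub_pos.2 (one_lt_pow₀ hQ hi0)).ne']

theorem gbinom_add_succ (d k : ℕ) (Q : ℝ) :
    gbinom (d + (k + 1)) (k + 1) Q
      = gbinom (d + k) k Q * ((Q ^ (d + k + 1) - 1) / (Q ^ (k + 1) - 1)) := by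
  unfold gbinom
  rw [Finset.prod_Icc_succ_top (by omega)]
  simp only [Nat.add_sub_cancel, add_assoc]

theorem gbinom_succ_add_mul (d k : ℕ) (Q : ℝ) :
    gbinom (d + 1 + k) k Q * (Q ^ (d + 1) - 1) = gbinom (d + k) k Q * (Q ^ (d + k + 1) - 1) := by
  induction k with
  | zero => simp [gbinom_zero_right]
  | succ k ih =>
    rw [gbinom_add_succ, gbinom_add_succ, mul_right_comm, ih]
    ring

theorem gbinom_succ_succ_mul (d k : ℕ) {Q : ℝ} (hQ : 1 < Q) :
    gbinom (d + k + 2) (k + 1) Q * ((Q ^ (k + 1) - 1) * (Q ^ (d + 1) - 1))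
      = gbinom (d + k) k Q * ((Q ^ (d + k + 2) - 1) * (Q ^ (d + k + 1) - 1)) := by
  have hk : Q ^ (k + 1) - 1 ≠ 0 := (sub_pos.2 (one_lt_pow₀ hQ k.succ_ne_zero)).ne'
  have h := gbinom_succ_add_mul d k Q
  rw [show d + k + 2 = d + 1 + (k + 1) by ring, gbinom_add_succ,
    show d + 1 + k + 1 = d + 1 + (k + 1) by ring]
  field_simp
  linear_combination (Q ^ (d + 1 + (k + 1)) - 1) * h

theorem gbinom_succ_succ_le (d k : ℕ) {Q : ℝ} (hQ : 1 < Q) :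
    gbinom (d + k + 2) (k + 1) Q ≤ (∑ i ∈ Finset.range (d + k + 2), Q ^ i) * gbinom (d + k) k Q := by
  have hk : 0 < Q ^ (k + 1) - 1 := sub_pos.2 (one_lt_pow₀ hQ k.succ_ne_zero)
  have hd : 0 < Q ^ (d + 1) - 1 := sub_pos.2 (one_lt_pow₀ hQ d.succ_ne_zero)
  have hT : 0 ≤ ∑ i ∈ Finset.range (d + k + 2), Q ^ i :=
    Finset.sum_nonneg fun i _ => by positivity
  refine le_of_mul_le_mul_right ?_ (mul_pos hk hd)
  rw [gbinom_succ_succ_mul d k hQ, ← geom_sum_mul Q (d + k + 2)]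
  have hP : (Q - 1) * (Q ^ (d + k + 1) - 1) ≤ (Q ^ (k + 1) - 1) * (Q ^ (d + 1) - 1) := by
    have h1 : 0 ≤ Q ^ k - 1 := sub_nonneg.2 (one_le_pow₀ hQ.le)
    have h2 : 0 ≤ Q ^ d - 1 := sub_nonneg.2 (one_le_pow₀ hQ.le)
    have h3 : 0 ≤ Q * ((Q ^ k - 1) * (Q ^ d - 1)) := by positivity
    linear_combination h3
  calc gbinom (d + k) k Q *
        ((∑ i ∈ Finset.range (d + k + 2), Q ^ i) * (Q - 1) * (Q ^ (d + k + 1) - 1))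
      = ((∑ i ∈ Finset.range (d + k + 2), Q ^ i) * gbinom (d + k) k Q) *
        ((Q - 1) * (Q ^ (d + k + 1) - 1)) := by ring
    _ ≤ _ := mul_le_mul_of_nonneg_left hP (mul_nonneg hT (gbinom_nonneg _ _ hQ))

theorem geom_sum_le_add_one_pow (n : ℕ) {Q : ℝ} (hQ : 0 ≤ Q) :
    ∑ i ∈ Finset.range (n + 1), Q ^ i ≤ (Q + 1) ^ n := by
  rw [add_pow]
  refine Finset.sum_le_sum fun i hi => ?_
  have hc : (1 : ℝ) ≤ n.choose i := by
    exact_mod_cast Nat.choose_pos (Nat.lt_succ_iff.1 (Finset.mem_range.1 hi))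
  rw [one_pow, mul_one]
  exact le_mul_of_one_le_right (by positivity) hc

theorem pow_add_two_le (n : ℕ) {X : ℝ} (hX : 0 ≤ X) : X ^ (n + 1) + 2 ≤ (X + 2) ^ (n + 1) := by
  induction n with
  | zero => simp
  | succ n ih =>
    have h : 0 ≤ X ^ (n + 1) := by positivity
    rw [pow_succ, pow_succ (X + 2)]
    nlinarith [mul_le_mul_of_nonneg_right ih (show 0 ≤ X + 2 by positivity)]

theorem sum_gbinom_add_two_le (m : ℕ) {q : ℝ} (hq : 1 < q) :
    ∑ k ∈ Finset.range (m + 3), q ^ (2 * k * (m + 2 - k)) * gbinom (m + 2) k (q ^ 2)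
      ≤ (q ^ 2) ^ (m + 1) * (∑ i ∈ Finset.range (m + 2), (q ^ 2) ^ i) *
          (∑ k ∈ Finset.range (m + 1), q ^ (2 * k * (m - k)) * gbinom m k (q ^ 2)) + 2 := by
  have hQ : 1 < q ^ 2 := one_lt_pow₀ hq two_ne_zero
  rw [Finset.sum_range_succ, Finset.sum_range_succ', gbinom_self _ hQ, gbinom_zero_right,
    Finset.mul_sum, add_assoc]
  refine add_le_add (Finset.sum_le_sum fun k hk => ?_) (by norm_num)
  obtain ⟨d, rfl⟩ : ∃ d, m = d + k :=
    ⟨m - k, by have := Finset.mem_range.1 hk; omega⟩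
  rw [show d + k + 2 - (k + 1) = d + 1 by omega, Nat.add_sub_cancel]
  calc q ^ (2 * (k + 1) * (d + 1)) * gbinom (d + k + 2) (k + 1) (q ^ 2)
      ≤ q ^ (2 * (k + 1) * (d + 1)) *
          ((∑ i ∈ Finset.range (d + k + 2), (q ^ 2) ^ i) * gbinom (d + k) k (q ^ 2)) :=
        mul_le_mul_of_nonneg_left (gbinom_succ_succ_le d k hQ) (by positivity)
    _ = _ := by
      rw [← pow_mul, show 2 * (k + 1) * (d + 1) = 2 * (d + k + 1) + 2 * k * d by ring, pow_add]
      ring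

theorem sum_gbinom_add_two_le_mul (m : ℕ) {q B : ℝ} (hq : 1 < q) (hB : 1 ≤ B)
    (h : ∑ k ∈ Finset.range (m + 1), q ^ (2 * k * (m - k)) * gbinom m k (q ^ 2) ≤ B) :
    ∑ k ∈ Finset.range (m + 3), q ^ (2 * k * (m + 2 - k)) * gbinom (m + 2) k (q ^ 2)
      ≤ B * (q + 1) ^ (4 * (m + 1)) := by
  have hX : q ^ 2 * (q ^ 2 + 1) + 2 ≤ (q + 1) ^ 4 := by
    nlinarith [pow_pos (zero_lt_one.trans hq) 3, sq_nonneg q]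
  have hR : (q ^ 2) ^ (m + 1) * (∑ i ∈ Finset.range (m + 2), (q ^ 2) ^ i) + 2
      ≤ (q + 1) ^ (4 * (m + 1)) :=
    calc _ ≤ (q ^ 2) ^ (m + 1) * (q ^ 2 + 1) ^ (m + 1) + 2 := by
          gcongr
          exact geom_sum_le_add_one_pow (m + 1) (sq_nonneg q)
      _ = (q ^ 2 * (q ^ 2 + 1)) ^ (m + 1) + 2 := by rw [mul_pow]
      _ ≤ (q ^ 2 * (q ^ 2 + 1) + 2) ^ (m + 1) := pow_add_two_le m (by positivity)
      _ ≤ ((q + 1) ^ 4) ^ (m + 1) := by gcongr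
      _ = (q + 1) ^ (4 * (m + 1)) := (pow_mul _ _ _).symm
  calc _ ≤ (q ^ 2) ^ (m + 1) * (∑ i ∈ Finset.range (m + 2), (q ^ 2) ^ i) * B + 2 := by
        refine (sum_gbinom_add_two_le m hq).trans ?_
        gcongr
    _ ≤ B * ((q ^ 2) ^ (m + 1) * (∑ i ∈ Finset.range (m + 2), (q ^ 2) ^ i) + 2) := by
        linarith
    _ ≤ B * (q + 1) ^ (4 * (m + 1)) := by gcongr

theorem sum_gbinom_even_le (n : ℕ) {q : ℝ} (hq : 1 < q) :
    ∑ k ∈ Finset.range (2 * n + 1), q ^ (2 * k * (2 * n - k)) * gbinom (2 * n) k (q ^ 2)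
      ≤ (q + 1) ^ ((2 * n) ^ 2) := by
  induction n with
  | zero => simp [gbinom_zero_right]
  | succ n ih =>
    refine (sum_gbinom_add_two_le_mul (2 * n) hq (one_le_pow₀ (by linarith)) ih).trans_eq ?_
    rw [← pow_add]
    ring_nf

theorem sum_gbinom_odd_le (n : ℕ) {q : ℝ} (hq : 1 < q) :
    ∑ k ∈ Finset.range (2 * n + 1 + 1),
        q ^ (2 * k * (2 * n + 1 - k)) * gbinom (2 * n + 1) k (q ^ 2)
      ≤ 2 * (q + 1) ^ ((2 * n + 1) ^ 2 - 1) := by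
  induction n with
  | zero =>
    have hQ : 1 < q ^ 2 := one_lt_pow₀ hq two_ne_zero
    norm_num [Finset.sum_range_succ, gbinom_zero_right, gbinom_self 1 hQ]
  | succ n ih =>
    have hB : 1 ≤ (q + 1) ^ ((2 * n + 1) ^ 2 - 1) := one_le_pow₀ (by linarith)
    refine (sum_gbinom_add_two_le_mul (2 * n + 1) hq (by linarith) ih).trans_eq ?_
    rw [mul_assoc, ← pow_add]
    congr 2
    have h1 : (2 * n + 1) ^ 2 = 4 * n ^ 2 + 4 * n + 1 := by ring
    have h2 : (2 * (n + 1) + 1) ^ 2 = 4 * n ^ 2 + 12 * n + 9 := by ring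
    omega

theorem stmt_16 (m : ℕ) (hm : 1 ≤ m) (q : ℝ) (hq : 1 < q) :
    (Odd m →
      ∑ k ∈ Finset.range (m + 1), q ^ (2 * k * (m - k)) * gbinom m k (q ^ 2)
        ≤ 2 * (q + 1) ^ (m ^ 2 - 1)) ∧
    (Even m →
      ∑ k ∈ Finset.range (m + 1), q ^ (2 * k * (m - k)) * gbinom m k (q ^ 2)
        ≤ (q + 1) ^ (m ^ 2)) := by
  refine ⟨?_, fun h => ?_⟩
  · rintro ⟨n, rfl⟩
    exact sum_gbinom_odd_le n hq
  · obtain ⟨n, rfl⟩ := h.exists_two_nsmul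
    exact sum_gbinom_even_le n hq

end
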